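/- Let q ≥ 2 and k, ℓ, n ≥ 1 be integers. A code C ⊆ Z_q^n corrects an unbounded number of tandem duplications of length k in the ℓ-read channel if and only if the map x ↦ N_{k,ℓ}(x) is injective on C. Consequently, the maximum cardinality of a code C ⊆ Z_q^n correcting an unbounded number of tandem duplications of length k in the ℓ-read channel equals |{N_{k,ℓ}(x) : x ∈ Z_q^n}|. -/

import Mathlib

/-- The composition of a word over `Fin q`, as an element of `ℤ^q`:
it counts, for each letter `a`, the number of occurrences of `a`. -/
def comp {q : ℕ} (w : List (Fin q)) : Fin q → ℤ := fun a => (w.count a : ℤ)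

/-- The `ℓ`-read vector of a word over `Fin q`: a word of length `n + ℓ - 1`
over `ℤ^q` whose `p`-th entry is the composition of the window of the last `ℓ`
symbols ending at position `p` (symbols outside the word are omitted). -/
def readVec {q : ℕ} (ℓ : ℕ) (x : List (Fin q)) : List (Fin q → ℤ) :=
  (List.range (x.length + ℓ - 1)).map fun p => comp ((x.take (p + 1)).drop (p + 1 - ℓ))

/-- The `k`-step derivative of a word over an abelian group, with the
convention that entries at nonpositive positions are `0`. -/
def kderiv {G : Type*} [AddCommGroup G] (k : ℕ) (y : List G) : List G :=
  (List.range y.length).map fun i => y.getD i 0 - if k ≤ i then y.getD (i - k) 0 else 0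

/-- The lengths `(m_0, m_1, ..., m_s)` of the maximal (possibly empty) runs of
zeros in `y = 0^{m_0} y_1 0^{m_1} ⋯ y_s 0^{m_s}` with `y_1, ..., y_s ≠ 0`. -/
def zeroRuns {G : Type*} [Zero G] [DecidableEq G] (y : List G) : List ℕ :=
  (y.splitOnP fun a => decide (a ≠ 0)).map List.length

/-- `σ_k(y) = (⌊m_0/k⌋, ⌊m_1/k⌋, ..., ⌊m_s/k⌋)`. -/
def sigmak {G : Type*} [Zero G] [DecidableEq G] (k : ℕ) (y : List G) : List ℕ :=
  (zeroRuns y).map fun m => m / k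

/-- Interleave zero runs of the given lengths with the given (nonzero) letters:
`assemble (m_0 :: ... :: m_s) (y_1 :: ... :: y_s) = 0^{m_0} y_1 0^{m_1} ⋯ y_s 0^{m_s}`. -/
def assemble {G : Type*} [Zero G] : List ℕ → List G → List G
  | [], _ => []
  | m :: _, [] => List.replicate m (0 : G)
  | m :: ms, a :: as => List.replicate m (0 : G) ++ a :: assemble ms as

/-- `μ_k(y) = 0^{m_0 % k} y_1 0^{m_1 % k} ⋯ y_s 0^{m_s % k}`. -/
def muk {G : Type*} [Zero G] [DecidableEq G] (k : ℕ) (y : List G) : List G :=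
  assemble ((zeroRuns y).map fun m => m % k) (y.filter fun a => decide (a ≠ 0))

/-- The nucleus `N_{k,ℓ}(x) = μ_k(Δ_k(R_ℓ(x)))` of a word over `Fin q`. -/
def nucleus {q : ℕ} (k ℓ : ℕ) (x : List (Fin q)) : List (Fin q → ℤ) :=
  muk k (kderiv k (readVec ℓ x))

/-- A single tandem duplication of length `k`: `u v w ↦ u v v w` with `|v| = k`. -/
def TD {α : Type*} (k : ℕ) (y z : List α) : Prop :=
  ∃ u v w : List α, v.length = k ∧ y = u ++ (v ++ w) ∧ z = u ++ (v ++ (v ++ w))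

/-- `TDt k t y z` holds iff `z` arises from `y` by a sequence of exactly `t`
tandem duplications of length `k`, i.e. `y ⟹_k^t z`. -/
def TDt {α : Type*} (k : ℕ) : ℕ → List α → List α → Prop
  | 0 => fun y z => y = z
  | t + 1 => fun y z => ∃ w, TDt k t y w ∧ TD k w z

/-- The ball `B_{k,t}(y)`: all words obtained from `y` by at most `t` tandem
duplications of length `k`. -/
def Ball {α : Type*} (k t : ℕ) (y : List α) : Set (List α) :=
  {z | ∃ j ≤ t, TDt k j y z}

/-- `x` is `(k,ℓ)`-fine: it contains no `k`-periodic factor of length `2k+ℓ-1`. -/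
def Fine {q : ℕ} (k ℓ : ℕ) (x : List (Fin q)) : Prop :=
  ∀ i : ℕ, 1 ≤ i → i + 2 * k + ℓ - 2 ≤ x.length →
    (x.drop (i - 1)).take (k + ℓ - 1) ≠ (x.drop (i - 1 + k)).take (k + ℓ - 1)

/-- `y` contains the factor `0^k` (a run of `k` consecutive zeros). -/
def HasZeroBlock {G : Type*} [Zero G] (k : ℕ) (y : List G) : Prop :=
  ∃ j, j + k ≤ y.length ∧ (y.drop j).take k = List.replicate k (0 : G)

/-- `λ_{m,q}`: the largest real root of `x^{m+2} - q·x^{m+1} + q - 1`. -/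
noncomputable def lambdaRoot (m q : ℕ) : ℝ :=
  sSup {x : ℝ | x ^ (m + 2) - (q : ℝ) * x ^ (m + 1) + (q : ℝ) - 1 = 0}

/-- The dot product `a ⊙ b = Σ_{i=1}^{min(|a|,|b|)} a_i · b_i`. -/
def dot {G : Type*} [AddCommMonoid G] (a : List ℕ) (b : List G) : G :=
  (List.zipWith (fun m g => m • g) a b).sum

section TandemDuplication

variable {G : Type*}

/-- One insertion of the block `0^k`. -/
def ZeroInsert [Zero G] (k : ℕ) (d e : List G) : Prop :=
  ∃ u w : List G, d = u ++ w ∧ e = u ++ (List.replicate k 0 ++ w)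

theorem exists_TDt_iff_reflTransGen {α : Type*} {k : ℕ} {y z : List α} :
    (∃ t, TDt k t y z) ↔ Relation.ReflTransGen (TD k) y z := by
  constructor
  · rintro ⟨t, h⟩
    induction t generalizing z with
    | zero => obtain rfl : y = z := h; exact .refl
    | succ t ih => obtain ⟨w, hw, hz⟩ := h; exact (ih hw).tail hz
  · intro h
    induction h with
    | refl => exact ⟨0, rfl⟩
    | tail _ h ih => obtain ⟨t, ht⟩ := ih; exact ⟨t + 1, _, ht, h⟩

/-! ### Zero runs and `muk` -/

section ZeroRuns

variable [Zero G]

theorem eq_replicate_zero_or_append_cons (e : List G) :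
    (∃ m, e = List.replicate m 0) ∨
      ∃ m a r, a ≠ 0 ∧ e = List.replicate m 0 ++ a :: r := by
  induction e with
  | nil => exact .inl ⟨0, rfl⟩
  | cons b e ih =>
    by_cases hb : b = 0
    · subst hb
      rcases ih with ⟨m, rfl⟩ | ⟨m, a, r, ha, rfl⟩
      · exact .inl ⟨m + 1, rfl⟩
      · exact .inr ⟨m + 1, a, r, ha, rfl⟩
    · exact .inr ⟨0, b, e, hb, rfl⟩

theorem replicate_zero_append_cons_inj {m m' : ℕ} {a a' : G} (ha : a ≠ 0) (ha' : a' ≠ 0)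
    {r r' : List G}
    (h : List.replicate m 0 ++ a :: r = List.replicate m' 0 ++ a' :: r') :
    m = m' ∧ a = a' ∧ r = r' := by
  induction m generalizing m' with
  | zero => cases m' <;> simp_all [List.replicate_succ]
  | succ m ih =>
    cases m' with
    | zero =>
      simp only [List.replicate_succ, List.cons_append, List.replicate_zero, List.nil_append,
        List.cons.injEq] at h
      exact absurd h.1.symm ha'
    | succ m' =>
      simp only [List.replicate_succ, List.cons_append, List.cons.injEq, true_and] at h
      simpa using ih h

theorem ZeroInsert.append_left {k : ℕ} (c : List G) {d e : List G} (h : ZeroInsert k d e) :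
    ZeroInsert k (c ++ d) (c ++ e) := by
  obtain ⟨u, w, rfl, rfl⟩ := h
  exact ⟨c ++ u, w, by simp, by simp⟩

theorem reflTransGen_zeroInsert_replicate_append (k t : ℕ) (y : List G) :
    Relation.ReflTransGen (ZeroInsert k) y (List.replicate (k * t) 0 ++ y) := by
  induction t with
  | zero => exact .refl
  | succ t ih =>
    refine ih.tail ⟨[], _, rfl, ?_⟩
    rw [Nat.mul_succ, add_comm, List.replicate_add]
    exact List.append_assoc _ _ _

theorem reflTransGen_zeroInsert_of_mod_eq {k m m' : ℕ} (hm : m % k = m' % k) (hle : m ≤ m')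
    (y : List G) :
    Relation.ReflTransGen (ZeroInsert k) (List.replicate m 0 ++ y)
      (List.replicate m' 0 ++ y) := by
  obtain ⟨t, ht⟩ := (Nat.modEq_iff_dvd' hle).1 hm
  obtain rfl : m' = k * t + m := by omega
  rw [List.replicate_add, List.append_assoc]
  exact reflTransGen_zeroInsert_replicate_append k t _

theorem join_zeroInsert_of_mod_eq {k m m' : ℕ} (hm : m % k = m' % k) (y : List G) :
    Relation.Join (Relation.ReflTransGen (ZeroInsert k)) (List.replicate m 0 ++ y)
      (List.replicate m' 0 ++ y) := by
  rcases le_total m m' with h | h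
  · exact ⟨_, reflTransGen_zeroInsert_of_mod_eq hm h y, .refl⟩
  · exact ⟨_, .refl, reflTransGen_zeroInsert_of_mod_eq hm.symm h y⟩

variable [DecidableEq G]

theorem zeroRuns_zero_cons (y : List G) :
    zeroRuns (0 :: y) = (zeroRuns y).modifyHead (· + 1) := by
  unfold zeroRuns
  rw [List.splitOnP_cons_eq_if_modifyHead]
  rcases h : List.splitOnP (fun a : G => decide (a ≠ 0)) y with _ | ⟨a, l⟩ <;> simp

theorem zeroRuns_cons_of_ne_zero {a : G} (ha : a ≠ 0) (y : List G) :
    zeroRuns (a :: y) = 0 :: zeroRuns y := by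
  unfold zeroRuns
  rw [List.splitOnP_cons_eq_if_modifyHead]
  simp [ha]

theorem zeroRuns_ne_nil (y : List G) : zeroRuns y ≠ [] := by
  simp [zeroRuns, List.splitOnP_ne_nil]

theorem zeroRuns_replicate_append (m : ℕ) (y : List G) :
    zeroRuns (List.replicate m 0 ++ y) = (zeroRuns y).modifyHead (· + m) := by
  induction m with
  | zero => rcases h : zeroRuns y <;> simp [h]
  | succ m ih =>
    rw [List.replicate_succ, List.cons_append, zeroRuns_zero_cons, ih]
    rcases h : zeroRuns y <;> simp [add_assoc]

theorem zeroRuns_mod_insert (k : ℕ) (u w : List G) :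
    (zeroRuns (u ++ (List.replicate k 0 ++ w))).map (· % k) =
      (zeroRuns (u ++ w)).map (· % k) := by
  induction u with
  | nil =>
    rw [List.nil_append, List.nil_append, zeroRuns_replicate_append]
    rcases h : zeroRuns w <;> simp
  | cons a u ih =>
    by_cases ha : a = 0
    · subst ha
      rw [List.cons_append, List.cons_append, zeroRuns_zero_cons, zeroRuns_zero_cons]
      rcases h : zeroRuns (u ++ w) with _ | ⟨b, l⟩
      · exact absurd h (zeroRuns_ne_nil _)
      rcases h' : zeroRuns (u ++ (List.replicate k 0 ++ w)) with _ | ⟨b', l'⟩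
      · exact absurd h' (zeroRuns_ne_nil _)
      simp only [h, h', List.map_cons, List.cons.injEq] at ih
      simp only [List.modifyHead_cons, List.map_cons, List.cons.injEq]
      exact ⟨Nat.ModEq.add_right 1 ih.1, ih.2⟩
    · simp only [List.cons_append, zeroRuns_cons_of_ne_zero ha, List.map_cons, ih]

theorem ZeroInsert.muk_eq {k : ℕ} {d e : List G} (h : ZeroInsert k d e) :
    muk k e = muk k d := by
  obtain ⟨u, w, rfl, rfl⟩ := h
  unfold muk
  rw [zeroRuns_mod_insert]
  simp

theorem muk_replicate_append_cons (k m : ℕ) {a : G} (ha : a ≠ 0) (r : List G) :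
    muk k (List.replicate m 0 ++ a :: r) = List.replicate (m % k) 0 ++ a :: muk k r := by
  simp [muk, zeroRuns_replicate_append, zeroRuns_cons_of_ne_zero ha, ha, assemble]

theorem muk_replicate (k m : ℕ) :
    muk k (List.replicate m (0 : G)) = List.replicate (m % k) 0 := by
  have h := zeroRuns_replicate_append m ([] : List G)
  rw [List.append_nil] at h
  have h' : zeroRuns ([] : List G) = [0] := by simp [zeroRuns]
  rw [h', List.modifyHead_cons, zero_add] at h
  simp [muk, h, assemble]

theorem muk_append_of_forall_ne_zero (k : ℕ) {a : List G} (ha : ∀ g ∈ a, g ≠ 0) (e : List G) :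
    muk k (a ++ e) = a ++ muk k e := by
  induction a with
  | nil => rfl
  | cons g a ih =>
    have h := muk_replicate_append_cons k 0 (ha g (by simp)) (a ++ e)
    simp only [List.replicate_zero, List.nil_append, Nat.zero_mod] at h
    rw [List.cons_append, h, ih fun x hx => ha x (by simp [hx]), List.cons_append]

theorem join_zeroInsert_of_muk_eq {k : ℕ} {e e' : List G} (h : muk k e = muk k e') :
    Relation.Join (Relation.ReflTransGen (ZeroInsert k)) e e' := by
  rcases eq_replicate_zero_or_append_cons e with ⟨m, rfl⟩ | ⟨m, a, r, ha, rfl⟩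
  · rcases eq_replicate_zero_or_append_cons e' with ⟨m', rfl⟩ | ⟨m', a', r', ha', rfl⟩
    · rw [muk_replicate, muk_replicate] at h
      simpa using join_zeroInsert_of_mod_eq (by simpa using congrArg List.length h) ([] : List G)
    · rw [muk_replicate, muk_replicate_append_cons k m' ha'] at h
      exact absurd (List.eq_of_mem_replicate (h ▸ by simp : a' ∈ List.replicate (m % k) 0)) ha'
  · rcases eq_replicate_zero_or_append_cons e' with ⟨m', rfl⟩ | ⟨m', a', r', ha', rfl⟩
    · rw [muk_replicate, muk_replicate_append_cons k m ha] at h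
      exact absurd (List.eq_of_mem_replicate (h ▸ by simp : a ∈ List.replicate (m' % k) 0)) ha
    · rw [muk_replicate_append_cons k m ha, muk_replicate_append_cons k m' ha'] at h
      obtain ⟨hm, rfl, hr⟩ := replicate_zero_append_cons_inj ha ha' h
      obtain ⟨f, hf, hf'⟩ := join_zeroInsert_of_muk_eq hr
      have lift : ∀ (m : ℕ) {s : List G}, Relation.ReflTransGen (ZeroInsert k) s f →
          Relation.ReflTransGen (ZeroInsert k) (List.replicate m 0 ++ a :: s)
            (List.replicate m 0 ++ a :: f) := fun m s hs =>
        hs.lift (fun s => List.replicate m 0 ++ a :: s)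
          (fun _ _ h => (h.append_left [a]).append_left (List.replicate m 0))
      obtain ⟨g, hg, hg'⟩ := join_zeroInsert_of_mod_eq hm (a :: f)
      exact ⟨g, (lift m hf).trans hg, (lift m' hf').trans hg'⟩
termination_by e.length

end ZeroRuns

/-! ### The `k`-step derivative -/

section Derivative

variable [AddCommGroup G]

theorem kderiv_eq_zipWith (k : ℕ) (y : List G) :
    kderiv k y = List.zipWith (· - ·) y (List.replicate k 0 ++ y) := by
  apply List.ext_getElem
  · simp [kderiv]
  · intro i h₁ h₂
    have hi : i < y.length := by simpa [kderiv] using h₁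
    simp only [kderiv, List.getElem_map, List.getElem_range, List.getElem_zipWith,
      List.getElem_append, List.length_replicate, List.getElem_replicate]
    rw [List.getD_eq_getElem _ _ hi]
    by_cases hik : k ≤ i
    · rw [if_pos hik, dif_neg (by omega), List.getD_eq_getElem]
    · rw [if_neg hik, dif_pos (by omega)]

theorem zipWith_sub_append_injective {h : List G} (hh : h ≠ []) :
    Function.Injective fun y : List G => List.zipWith (· - ·) y (h ++ y) := by
  intro y
  induction y generalizing h with
  | nil =>
    intro y' hy
    have := congrArg List.length hy
    simp at this
    exact (List.length_eq_zero_iff.1 this.symm).symm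
  | cons a y ih =>
    intro y' hy
    obtain ⟨b, h, rfl⟩ := List.exists_cons_of_ne_nil hh
    rcases y' with _ | ⟨a', y'⟩
    · simp at hy
    · simp only [List.cons_append, List.zipWith_cons_cons, List.cons.injEq,
        sub_left_inj] at hy
      obtain ⟨rfl, hy⟩ := hy
      rw [ih (h := h ++ [a]) (by simp) (by simpa using hy)]

theorem kderiv_injective {k : ℕ} (hk : 1 ≤ k) :
    Function.Injective (kderiv k : List G → List G) := by
  intro y y' h
  rw [kderiv_eq_zipWith, kderiv_eq_zipWith] at h
  exact zipWith_sub_append_injective (h := List.replicate k 0)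
    (by simpa [List.replicate_eq_nil_iff] using (by omega : k ≠ 0)) h

theorem length_kderiv (k : ℕ) (y : List G) : (kderiv k y).length = y.length := by
  simp [kderiv]

theorem kderiv_append_append {k : ℕ} (u : List G) {v : List G} (hv : v.length = k) (w : List G) :
    kderiv k (u ++ (v ++ w)) = kderiv k (u ++ v) ++ List.zipWith (· - ·) w (v ++ w) := by
  have h₁ : List.replicate k (0 : G) ++ (u ++ v) = (List.replicate k 0 ++ u) ++ v := by simp
  have h₂ : List.replicate k (0 : G) ++ (u ++ (v ++ w)) =
      (List.replicate k 0 ++ u) ++ (v ++ w) := by simp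
  have hl : (u ++ v).length = (List.replicate k (0 : G) ++ u).length := by simp [hv, add_comm]
  rw [kderiv_eq_zipWith, kderiv_eq_zipWith, h₁, h₂, ← List.append_assoc u v w,
    List.zipWith_append hl]
  congr 1
  rw [← List.append_nil (u ++ v), List.append_nil (u ++ v)]
  conv_rhs => rw [← List.append_nil (u ++ v), List.zipWith_append hl]
  simp

theorem kderiv_duplicate {k : ℕ} (u : List G) {v : List G} (hv : v.length = k) (w : List G) :
    kderiv k (u ++ (v ++ (v ++ w))) =
      kderiv k (u ++ v) ++ (List.replicate k 0 ++ List.zipWith (· - ·) w (v ++ w)) := by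
  rw [kderiv_append_append u hv, List.zipWith_append rfl]
  congr 2
  rw [List.zipWith_self]
  simp [hv]

theorem TD.zeroInsert_kderiv {k : ℕ} {y z : List G} (h : TD k y z) :
    ZeroInsert k (kderiv k y) (kderiv k z) := by
  obtain ⟨u, v, w, hv, rfl, rfl⟩ := h
  exact ⟨_, _, kderiv_append_append u hv w, kderiv_duplicate u hv w⟩

theorem exists_TD_of_kderiv_eq_append {k : ℕ} {y p s : List G} (hp : k ≤ p.length)
    (h : kderiv k y = p ++ s) :
    ∃ z, TD k y z ∧ kderiv k z = p ++ (List.replicate k 0 ++ s) := by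
  have hlen : y.length = p.length + s.length := by
    rw [← length_kderiv k y, h, List.length_append]
  obtain ⟨u, v, w, hu, hv, rfl⟩ :
      ∃ u v w : List G, u.length = p.length - k ∧ v.length = k ∧ y = u ++ (v ++ w) :=
    ⟨y.take (p.length - k), (y.drop (p.length - k)).take k, (y.drop (p.length - k)).drop k,
      by simp; omega, by simp; omega, by simp only [List.take_append_drop]⟩
  rw [kderiv_append_append u hv] at h
  obtain ⟨hA, hB⟩ := List.append_inj h (by rw [length_kderiv, List.length_append]; omega)
  exact ⟨_, ⟨u, v, w, hv, rfl, rfl⟩, by rw [kderiv_duplicate u hv, hA, hB]⟩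

theorem exists_reflTransGen_TD_of_zeroInsert {k : ℕ} {y a e f : List G} (ha : a.length = k)
    (hy : kderiv k y = a ++ e) (h : Relation.ReflTransGen (ZeroInsert k) e f) :
    ∃ z, Relation.ReflTransGen (TD k) y z ∧ kderiv k z = a ++ f := by
  induction h with
  | refl => exact ⟨y, .refl, hy⟩
  | tail _ h ih =>
    obtain ⟨z, hyz, hz⟩ := ih
    obtain ⟨u, w, rfl, rfl⟩ := h
    obtain ⟨z', hzz', hz'⟩ := exists_TD_of_kderiv_eq_append (k := k) (p := a ++ u) (s := w)
      (by simp [ha]) (by rw [hz, List.append_assoc])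
    exact ⟨z', hyz.tail hzz', by rw [hz', List.append_assoc]⟩

theorem take_kderiv (k : ℕ) (y : List G) : (kderiv k y).take k = y.take k := by
  apply List.ext_getElem
  · simp [kderiv]
  · intro i h₁ h₂
    have hi : i < k ∧ i < y.length := by simpa using h₂
    simp [kderiv, hi.2, Nat.not_le.2 hi.1]

variable [DecidableEq G]

theorem muk_kderiv_eq_of_reflTransGen_TD {k : ℕ} {y z : List G}
    (h : Relation.ReflTransGen (TD k) y z) : muk k (kderiv k z) = muk k (kderiv k y) := by
  induction h with
  | refl => rfl
  | tail _ h ih => rw [h.zeroInsert_kderiv.muk_eq, ih]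

theorem join_TD_of_muk_kderiv_eq {k : ℕ} (hk : 1 ≤ k) {y y' : List G}
    (hlen : y.length = y'.length) (hy : ∀ g ∈ y, g ≠ 0) (hy' : ∀ g ∈ y', g ≠ 0)
    (h : muk k (kderiv k y) = muk k (kderiv k y')) :
    Relation.Join (Relation.ReflTransGen (TD k)) y y' := by
  have hd := List.take_append_drop k (kderiv k y)
  have hd' := List.take_append_drop k (kderiv k y')
  rw [take_kderiv] at hd hd'
  rw [← hd, ← hd', muk_append_of_forall_ne_zero k fun g hg => hy g (List.mem_of_mem_take hg),
    muk_append_of_forall_ne_zero k fun g hg => hy' g (List.mem_of_mem_take hg)] at h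
  obtain ⟨ha, he⟩ := List.append_inj h (by simp [hlen])
  by_cases hl : k ≤ y.length
  · obtain ⟨f, hf, hf'⟩ := join_zeroInsert_of_muk_eq he
    obtain ⟨z, hz, hzf⟩ := exists_reflTransGen_TD_of_zeroInsert (by simpa using hl) hd.symm hf
    obtain ⟨z', hz', hzf'⟩ :=
      exists_reflTransGen_TD_of_zeroInsert (by simpa using hlen ▸ hl) hd'.symm hf'
    obtain rfl : z = z' := kderiv_injective hk (by rw [hzf, hzf', ha])
    exact ⟨z, hz, hz'⟩
  · rw [List.take_of_length_le (by omega), List.take_of_length_le (by omega)] at ha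
    exact ⟨y, .refl, ha ▸ .refl⟩

end Derivative

/-! ### Read vectors -/

theorem comp_ne_zero {q : ℕ} {w : List (Fin q)} (hw : w ≠ []) : comp w ≠ 0 := by
  obtain ⟨a, w, rfl⟩ := List.exists_cons_of_ne_nil hw
  intro h
  have := congrFun h a
  simp [comp] at this
  omega

theorem length_readVec {q : ℕ} (ℓ : ℕ) (x : List (Fin q)) :
    (readVec ℓ x).length = x.length + ℓ - 1 := by
  simp [readVec]

theorem ne_zero_of_mem_readVec {q ℓ : ℕ} (hl : 1 ≤ ℓ) {x : List (Fin q)} (hx : x ≠ [])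
    {g : Fin q → ℤ} (hg : g ∈ readVec ℓ x) : g ≠ 0 := by
  have hpos := List.length_pos_iff.2 hx
  simp only [readVec, List.mem_map, List.mem_range] at hg
  obtain ⟨p, hp, rfl⟩ := hg
  apply comp_ne_zero
  rw [← List.length_pos_iff, List.length_drop, List.length_take]
  omega

theorem exists_common_descendant_iff_nucleus_eq {q k ℓ : ℕ} (hk : 1 ≤ k) (hl : 1 ≤ ℓ)
    {x x' : List (Fin q)} (hx : x ≠ []) (hlen : x.length = x'.length) :
    (∃ z, (∃ t, TDt k t (readVec ℓ x) z) ∧ ∃ t, TDt k t (readVec ℓ x') z) ↔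
      nucleus k ℓ x = nucleus k ℓ x' := by
  simp only [exists_TDt_iff_reflTransGen]
  constructor
  · rintro ⟨z, h, h'⟩
    exact (muk_kderiv_eq_of_reflTransGen_TD h).symm.trans (muk_kderiv_eq_of_reflTransGen_TD h')
  · have hx' : x' ≠ [] := by
      rw [← List.length_pos_iff] at hx ⊢
      omega
    exact join_TD_of_muk_kderiv_eq hk (by simp [length_readVec, hlen])
      (fun _ => ne_zero_of_mem_readVec hl hx) (fun _ => ne_zero_of_mem_readVec hl hx')

end TandemDuplication

theorem isGreatest_card_injOn {α β : Type*} [Finite α] (f : α → β) :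
    IsGreatest {m : ℕ | ∃ C : Finset α, Set.InjOn f ↑C ∧ C.card = m}
      (Set.range f).ncard := by
  constructor
  · obtain ⟨s, -, hs⟩ := (Set.surjOn_image f Set.univ).exists_bijOn_subset
    refine ⟨s.toFinite.toFinset, by simpa using hs.injOn, ?_⟩
    rw [← Set.ncard_eq_toFinset_card, ← Set.image_univ, ← hs.image_eq, hs.injOn.ncard_image]
  · rintro m ⟨C, hC, rfl⟩
    rw [← Set.ncard_coe_finset, ← hC.ncard_image]
    exact Set.ncard_le_ncard (Set.image_subset_range f _) (Set.finite_range f)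

/-- a code `C ⊆ Z_q^n` corrects an unbounded number of tandem
duplications of length `k` in the `ℓ`-read channel iff `x ↦ N_{k,ℓ}(x)` is
injective on `C`; consequently the maximum cardinality of such a code equals
`|{N_{k,ℓ}(x) : x ∈ Z_q^n}|`. -/
theorem stmt_3 (q k ℓ n : ℕ) (hq : 2 ≤ q) (hk : 1 ≤ k) (hl : 1 ≤ ℓ) (hn : 1 ≤ n) :
    (∀ C : Finset (Fin n → Fin q),
        ((∀ x ∈ C, ∀ x' ∈ C, x ≠ x' →
            ¬∃ z, (∃ t, TDt k t (readVec ℓ (List.ofFn x)) z) ∧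
              (∃ t, TDt k t (readVec ℓ (List.ofFn x')) z)) ↔
          Set.InjOn (fun x : Fin n → Fin q => nucleus k ℓ (List.ofFn x)) ↑C)) ∧
      IsGreatest
        {m : ℕ | ∃ C : Finset (Fin n → Fin q),
          (∀ x ∈ C, ∀ x' ∈ C, x ≠ x' →
            ¬∃ z, (∃ t, TDt k t (readVec ℓ (List.ofFn x)) z) ∧
              (∃ t, TDt k t (readVec ℓ (List.ofFn x')) z)) ∧ C.card = m}
        (Set.ncard (Set.range fun x : Fin n → Fin q => nucleus k ℓ (List.ofFn x))) := by
  have key : ∀ C : Finset (Fin n → Fin q),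
      (∀ x ∈ C, ∀ x' ∈ C, x ≠ x' →
        ¬∃ z, (∃ t, TDt k t (readVec ℓ (List.ofFn x)) z) ∧
          (∃ t, TDt k t (readVec ℓ (List.ofFn x')) z)) ↔
        Set.InjOn (fun x : Fin n → Fin q => nucleus k ℓ (List.ofFn x)) ↑C := by
    intro C
    have common (x x' : Fin n → Fin q) := exists_common_descendant_iff_nucleus_eq
      (x := List.ofFn x) (x' := List.ofFn x') hk hl
      (List.length_pos_iff.1 (by rwa [List.length_ofFn])) (by simp)
    simp only [common]
    exact ⟨fun h x hx x' hx' hN => of_not_not fun hne => h x hx x' hx' hne hN,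
      fun h x hx x' hx' hne hN => hne (h hx hx' hN)⟩
  refine ⟨key, ?_⟩
  simp only [key]
  exact isGreatest_card_injOn _
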